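/- arXiv:2509.03784 — 2 statements merged into one kernel-verified Lean document; each statement's English description precedes it below -/
import Mathlib

section
/- There exists a 3-coloring of the edges of the complete graph K_34 containing no copy of K_4 in the first color and no copy of K_4 minus an edge in either of the other two colors; consequently the Ramsey number R(K_4, K_4−e, K_4−e) is at least 35. -/
open SimpleGraph

/-- `HasCopy H G` means the graph `H` contains a (not necessarily induced) copy of `G`. -/
def HasCopy {α β : Type*} (H : SimpleGraph α) (G : SimpleGraph β) : Prop :=
  ∃ f : β ↪ α, ∀ a b, G.Adj a b → H.Adj (f a) (f b)

/-- The graph on `Fin n` consisting of the edges assigned color `i` by the edge coloring `c`. -/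
def colorGraph {V : Type*} {k : ℕ} (c : Sym2 V → Fin k) (i : Fin k) : SimpleGraph V :=
  SimpleGraph.fromRel (fun a b => c s(a, b) = i)

/-- `K₄ − e`: the complete graph on 4 vertices with the edge `{0,1}` removed. -/
def K4minus : SimpleGraph (Fin 4) :=
  SimpleGraph.fromEdgeSet {s(0, 2), s(0, 3), s(1, 2), s(1, 3), s(2, 3)}

/-- The colouring table of `K₃₄`, found by a SAT search for colourings invariant under a
permutation with cycle type `8,8,8,8,2`: base-4 digit number `34 * a + b` is the colour of `ab`. -/
def colorTable : ℕ :=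
  7983413219779290738426443459034738529008186838345113634878709889133156502800310608141511163481167891403780228876710321796071267230842430766613585817151818196326780926540386561631054736808654698383572445867263596956811817965361791288777522491715247643573363321090243542986686064341129956338682108628785809298473945898629946090635869118830294987682562164301217410441683500825583029442968329599180768129912271280075518239599501797174623399417806360674214396384403699934718961341108999788290389411519354777477225220545752862798852073423411837630427090617052842373996985320902189370607600783336782568810973690945069137271397223357996568323705485173865487473463854004037476396572282163761096952415560

/-- The colour of the pair `a, b`. -/
def tableColor (a b : ℕ) : ℕ := (colorTable >>> (2 * (34 * a + b))) % 4

/-- Boolean test: `ab` is an edge of colour `i`. -/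
def isEdge (i a b : ℕ) : Bool := !(Nat.beq a b) && Nat.beq (tableColor a b % 3) i

/-- Boolean test: there is no `K₄` in colour 0. -/
def checkK4 : Bool :=
  (List.range 34).all fun a => (List.range 34).all fun b => !(isEdge 0 a b) ||
    (List.range 34).all fun c => !(isEdge 0 a c && isEdge 0 b c) ||
      (List.range 34).all fun d => !(isEdge 0 a d && (isEdge 0 b d && isEdge 0 c d))

/-- Boolean test: no two triangles of colour `i` share an edge. -/
def checkK4minus (i : ℕ) : Bool :=
  (List.range 34).all fun a => (List.range 34).all fun b => !(isEdge i a b) ||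
    (List.range 34).all fun c => !(isEdge i a c && isEdge i b c) ||
      (List.range 34).all fun d => !(isEdge i a d && isEdge i b d) || Nat.beq c d

theorem tableColor_symm : ∀ a < 34, ∀ b < 34, tableColor a b = tableColor b a := by
  decide +kernel

theorem checkK4_true : checkK4 = true := by decide +kernel

theorem check1_true : checkK4minus 1 = true := by decide +kernel

theorem check2_true : checkK4minus 2 = true := by decide +kernel

theorem isEdge_of_adj (i : Fin 3) (h) (a b : Fin 34)
    (hab : (colorGraph (Sym2.lift ⟨fun a b : Fin 34 => Fin.ofNat 3 (tableColor a b), h⟩) i).Adj a b) :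
    isEdge i a b = true := by
  simp only [colorGraph, SimpleGraph.fromRel_adj, Sym2.lift_mk] at hab
  obtain ⟨hne, hc⟩ := hab
  have hc' : Fin.ofNat 3 (tableColor a b) = i := by
    rcases hc with hc | hc
    · exact hc
    · rw [tableColor_symm a.1 a.2 b.1 b.2]; exact hc
  have hv : tableColor a b % 3 = i := by rw [← hc']; rfl
  have hne' : (a : ℕ) ≠ b := fun hh => hne (Fin.ext hh)
  have hb : Nat.beq a b = false := by
    rw [← Bool.not_eq_true]
    exact fun hh => hne' (Nat.eq_of_beq_eq_true hh)
  simp [isEdge, hv, hb]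

theorem no_K4minus (G : SimpleGraph (Fin 34)) (i : ℕ)
    (hG : ∀ a b, G.Adj a b → isEdge i a b = true) (h : checkK4minus i = true) :
    ¬ HasCopy G K4minus := by
  rintro ⟨f, hf⟩
  simp only [checkK4minus, List.all_eq_true, List.mem_range, Bool.or_eq_true,
    Bool.not_eq_true', Bool.and_eq_false_iff] at h
  have e23 := hG _ _ (hf 2 3 (by simp [K4minus]))
  have e20 := hG _ _ (hf 2 0 (by simp [K4minus]))
  have e30 := hG _ _ (hf 3 0 (by simp [K4minus]))
  have e21 := hG _ _ (hf 2 1 (by simp [K4minus]))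
  have e31 := hG _ _ (hf 3 1 (by simp [K4minus]))
  have h1 := h _ (f 2).2 _ (f 3).2
  rw [e23] at h1
  have h2 := (h1.resolve_left (by simp)) _ (f 0).2
  rw [e20, e30] at h2
  have h3 := (h2.resolve_left (by simp)) _ (f 1).2
  rw [e21, e31] at h3
  have h4 := h3.resolve_left (by simp)
  have h5 : f 0 = f 1 := Fin.ext (Nat.eq_of_beq_eq_true h4)
  exact absurd (f.injective h5) (by decide)

/-- There is a 3-coloring of the edges of `K₃₄` with no `K₄` in color 0 and no `K₄ − e` in
colors 1 and 2; consequently `R(K₄, K₄−e, K₄−e) ≥ 35`. -/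
theorem ramsey_K4_K4e_K4e_ge_35 :
    ∃ c : Sym2 (Fin 34) → Fin 3,
      ¬ HasCopy (colorGraph c 0) (⊤ : SimpleGraph (Fin 4)) ∧
      ¬ HasCopy (colorGraph c 1) K4minus ∧
      ¬ HasCopy (colorGraph c 2) K4minus := by
  refine ⟨Sym2.lift ⟨fun a b => Fin.ofNat 3 (tableColor a b), fun a b => ?_⟩, ?_, ?_, ?_⟩
  · have h := tableColor_symm a.1 a.2 b.1 b.2
    simp only [h]
  · rintro ⟨f, hf⟩
    have key : ∀ x y : Fin 4, x ≠ y → isEdge 0 (f x) (f y) = true := by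
      intro x y hxy
      exact isEdge_of_adj _ _ _ _ (hf x y hxy)
    have h := checkK4_true
    simp only [checkK4, List.all_eq_true, List.mem_range, Bool.or_eq_true,
      Bool.not_eq_true', Bool.and_eq_false_iff] at h
    have h1 := h _ (f 0).2 _ (f 1).2
    have e01 := key 0 1 (by decide)
    have e02 := key 0 2 (by decide)
    have e03 := key 0 3 (by decide)
    have e12 := key 1 2 (by decide)
    have e13 := key 1 3 (by decide)
    have e23 := key 2 3 (by decide)
    rw [e01] at h1
    have h2 := (h1.resolve_left (by simp)) _ (f 2).2
    rw [e02, e12] at h2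
    have h3 := (h2.resolve_left (by simp)) _ (f 3).2
    rw [e03, e13, e23] at h3
    simp at h3
  · exact no_K4minus _ 1 (fun _ _ h => isEdge_of_adj _ _ _ _ h) check1_true
  · exact no_K4minus _ 2 (fun _ _ h => isEdge_of_adj _ _ _ _ h) check2_true
end

section
/- There exists a 4-coloring of the edges of the complete graph K_48 containing no triangle in color 1, no K_4 in color 2, and no 4-cycle in colors 3 or 4; consequently R(K_3, K_4, C_4, C_4) ≥ 49. -/
open SimpleGraph

/-- Adjacency rows (as bit masks) of the four color classes. -/
def rows48 : Nat → List Nat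
  | 0 => [
    0x15628989a802, 0x2a9146465401, 0x46a815159108, 0x89542a2a6204,
    0x542a91918920, 0xa81562624610, 0x628954541580, 0x9146a8a82a40,
    0x81502a2a6054, 0x42a0151590a8, 0x14608989a062, 0x289046465091,
    0x1106a8a80a46, 0x220954540589, 0x440a9191092a, 0x880562620615,
    0xa80562624615, 0x540a9191892a, 0x9106a8a82a46, 0x620954541589,
    0x89502a2a6254, 0x46a0151591a8, 0x15608989a862, 0x2a9046465491,
    0xa80562624615, 0x540a9191892a, 0x9106a8a82a46, 0x620954541589,
    0x89502a2a6254, 0x46a0151591a8, 0x15608989a862, 0x2a9046465491,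
    0x05620909a062, 0x0a9106065091, 0x06a8050590a8, 0x09540a0a6054,
    0x502a9090092a, 0xa01560600615, 0x608950500589, 0x9046a0a00a46,
    0x620954541189, 0x9106a8a82246, 0xa80562624415, 0x540a9191882a,
    0x2a9046461491, 0x156089892862, 0x89502a2a4254, 0x46a0151581a8]
  | 1 => [
    0xca1c1636539c, 0xc52c2939a36c, 0x39434aca6c53, 0x368385c59ca3,
    0xa3c4646c36c5, 0x53c8989c39ca, 0x9c32a2a3ca36, 0x6c315153c539,
    0x3686c5c59ca3, 0x3949caca6c53, 0xca1a3636539c, 0xc5253939a36c,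
    0x6c615353c539, 0x9c92a3a3ca36, 0xa3a46c6c36c5, 0x53589c9c39ca,
    0x535a1c9c39ca, 0xa3a52c6c36c5, 0x6c694353c539, 0x9c9683a3ca36,
    0x36a6c4c59ca3, 0x3959c8ca6c53, 0xca9a3236539c, 0xc5653139a36c,
    0x53309c8c398a, 0xa3306c4c3645, 0x6cc05313c519, 0x9cc0a323ca26,
    0x360cc5c19ca1, 0x390ccac26c52, 0xca0336345394, 0xc5033938a368,
    0x929cc0a61a8c, 0x616cc059254c, 0x5853309a4913, 0xa4a330658623,
    0x25c50369a4c1, 0x1aca039658c2, 0x86360ca59234, 0x49390c5a6138,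
    0x9c92a3a3ca36, 0x6c615353c539, 0x53589c9c39ca, 0xa3a46c6c36c5,
    0xc5253939a36c, 0xca1a3636539c, 0x3686c5c59ca3, 0x3949caca6c53]
  | 2 => [
    0x000120400400, 0x000210800800, 0x000480200200, 0x000840100100,
    0x001008024000, 0x002004018000, 0x004001082000, 0x008002041000,
    0x082010000008, 0x041020000004, 0x018040000001, 0x024080000002,
    0x800804000080, 0x400408000040, 0x100102000010, 0x200201000020,
    0x042080000020, 0x081040000010, 0x028010000080, 0x014020000040,
    0x400801000008, 0x800402000004, 0x200104000001, 0x100208000002,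
    0x048200108040, 0x084100204080, 0x021800401020, 0x012400802010,
    0x402100040102, 0x801200080201, 0x208400020408, 0x104800010804,
    0x400012404001, 0x800021808002, 0x200048202004, 0x100084101008,
    0x020024020210, 0x010018010120, 0x080082080840, 0x040041040480,
    0x002008080400, 0x001004040800, 0x008001010200, 0x004002020100,
    0x000880804000, 0x000440408000, 0x000110102000, 0x000220201000]
  | _ => [
    0x208040000060, 0x104080000090, 0x8010200000a0, 0x402010000050,
    0x08010200000a, 0x040201000005, 0x010408000009, 0x020804000006,
    0x400900100200, 0x800600200100, 0x200500400800, 0x100a00800400,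
    0x029000042000, 0x016000081000, 0x085000028000, 0x04a000014000,
    0x008001008000, 0x004002004000, 0x001004001000, 0x002008002000,
    0x000110000100, 0x000220000200, 0x000440000400, 0x000880000800,
    0x004800010020, 0x008400020010, 0x002100040080, 0x001200080040,
    0x008200100008, 0x004100200004, 0x001800400001, 0x002400800002,
    0x280024100510, 0x140018200a20, 0x810082400640, 0x420041800980,
    0x880048045004, 0x44008408a008, 0x110021026002, 0x220012019001,
    0x004400002040, 0x008800001080, 0x002200008020, 0x001100004010,
    0x004200000802, 0x008100000401, 0x002800000108, 0x001400000204]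

/-- Row of vertex `a` in color `k`. -/
def row48 (k a : Nat) : Nat := (rows48 k).getD a 0

/-- The color of the pair `a b`. -/
def col48 (a b : Fin 48) : Fin 4 :=
  if (row48 0 a).testBit b && (row48 0 b).testBit a then 0
  else if (row48 2 a).testBit b && (row48 2 b).testBit a then 2
  else if (row48 3 a).testBit b && (row48 3 b).testBit a then 3
  else 1

theorem col48_comm (a b : Fin 48) : col48 a b = col48 b a := by
  unfold col48
  rw [Bool.and_comm, Bool.and_comm (x := (row48 2 a).testBit b),
    Bool.and_comm (x := (row48 3 a).testBit b)]

theorem col48_row : ∀ a b : Fin 48, a ≠ b → (row48 (col48 a b) a).testBit b = true := by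
  decide +kernel

theorem tri48 : (List.range 48).all (fun a => (List.range 48).all (fun b =>
    !(row48 0 a).testBit b || (row48 0 a &&& row48 0 b) == 0)) = true := by
  decide +kernel

theorem k448 : (List.range 48).all (fun a => (List.range 48).all (fun b =>
    !(row48 1 a).testBit b || (List.range 48).all (fun c =>
      !(row48 1 a &&& row48 1 b).testBit c ||
        ((row48 1 a &&& row48 1 b) &&& row48 1 c) == 0))) = true := by
  decide +kernel

/-- Boolean check: any two distinct vertices have at most one common neighbor in color `k`. -/
def c4check (k : Nat) : Bool := (List.range 48).all (fun a => (List.range 48).all (fun b =>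
    a == b || ((row48 k a &&& row48 k b) &&& ((row48 k a &&& row48 k b) - 1)) == 0))

theorem bit_unique {m c d : Nat} (h : m &&& (m - 1) = 0) (hc : m.testBit c = true)
    (hd : m.testBit d = true) : c = d := by
  have hm : m ≠ 0 := by
    rintro rfl
    simp at hc
  obtain ⟨k, rfl⟩ := (Nat.and_sub_one_eq_zero_iff_isPowerOfTwo hm).1 h
  rw [Nat.testBit_two_pow] at hc hd
  simp only [decide_eq_true_eq] at hc hd
  omega

theorem c4_two : c4check 2 = true := by decide +kernel

theorem c4_three : c4check 3 = true := by decide +kernel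

/-- The coloring. -/
def color48 : Sym2 (Fin 48) → Fin 4 := Sym2.lift ⟨col48, col48_comm⟩

theorem adj_row {i : Fin 4} {a b : Fin 48} (h : (colorGraph color48 i).Adj a b) :
    (row48 i a).testBit b = true := by
  rw [colorGraph, SimpleGraph.fromRel_adj] at h
  obtain ⟨hne, h⟩ := h
  have h1 : col48 a b = i := by
    rcases h with h | h
    · exact h
    · rw [col48_comm]; exact h
  rw [← h1]
  exact col48_row a b hne

theorem no_c4 (i : Fin 4) (hi : c4check i = true) :
    ¬ HasCopy (colorGraph color48 i) (SimpleGraph.cycleGraph 4) := by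
  rintro ⟨f, hf⟩
  have h01 := adj_row (hf 0 1 (by decide))
  have h03 := adj_row (hf 0 3 (by decide))
  have h21 := adj_row (hf 2 1 (by decide))
  have h23 := adj_row (hf 2 3 (by decide))
  have hne : f 0 ≠ f 2 := fun h => absurd (f.injective h) (by decide)
  have hne' : f 1 ≠ f 3 := fun h => absurd (f.injective h) (by decide)
  unfold c4check at hi
  simp only [List.all_eq_true, List.mem_range, Bool.or_eq_true, beq_iff_eq,
    Bool.not_eq_true'] at hi
  have key := (hi (f 0) (f 0).2 (f 2) (f 2).2).resolve_left (fun h => hne (Fin.ext h))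
  exact hne' (Fin.ext (bit_unique key (by simp [Nat.testBit_and, h01, h21])
    (by simp [Nat.testBit_and, h03, h23])))

theorem no_tri : ¬ HasCopy (colorGraph color48 0) (⊤ : SimpleGraph (Fin 3)) := by
  rintro ⟨f, hf⟩
  have h01 := adj_row (hf 0 1 (by decide))
  have h02 := adj_row (hf 0 2 (by decide))
  have h12 := adj_row (hf 1 2 (by decide))
  have hi := tri48
  simp only [List.all_eq_true, List.mem_range, Bool.or_eq_true, beq_iff_eq,
    Bool.not_eq_true'] at hi
  have key := (hi (f 0) (f 0).2 (f 1) (f 1).2).resolve_left (by simpa using h01)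
  have := congrArg (fun m => m.testBit (f 2)) key
  simp only [Nat.testBit_and, Nat.zero_testBit] at this
  simp at h02 h12
  simp [h02, h12] at this

theorem no_k4 : ¬ HasCopy (colorGraph color48 1) (⊤ : SimpleGraph (Fin 4)) := by
  rintro ⟨f, hf⟩
  have h01 := adj_row (hf 0 1 (by decide))
  have h02 := adj_row (hf 0 2 (by decide))
  have h03 := adj_row (hf 0 3 (by decide))
  have h12 := adj_row (hf 1 2 (by decide))
  have h13 := adj_row (hf 1 3 (by decide))
  have h23 := adj_row (hf 2 3 (by decide))
  have hi := k448
  simp only [List.all_eq_true, List.mem_range, Bool.or_eq_true, beq_iff_eq,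
    Bool.not_eq_true'] at hi
  simp only [Fin.val_one] at h01 h02 h03 h12 h13 h23
  have key := (hi (f 0) (f 0).2 (f 1) (f 1).2).resolve_left (by simp [h01])
  have key2 := (key (f 2) (f 2).2).resolve_left (by simp [Nat.testBit_and, h02, h12])
  have := congrArg (fun m => m.testBit (f 3)) key2
  simp [Nat.testBit_and, h03, h13, h23] at this

/-- There is a 4-coloring of the edges of `K₄₈` with no triangle in color 0, no `K₄` in
color 1 and no 4-cycle in colors 2 and 3; consequently `R(K₃, K₄, C₄, C₄) ≥ 49`. -/
theorem ramsey_K3_K4_C4_C4_ge_49 :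
    ∃ c : Sym2 (Fin 48) → Fin 4,
      ¬ HasCopy (colorGraph c 0) (⊤ : SimpleGraph (Fin 3)) ∧
      ¬ HasCopy (colorGraph c 1) (⊤ : SimpleGraph (Fin 4)) ∧
      ¬ HasCopy (colorGraph c 2) (SimpleGraph.cycleGraph 4) ∧
      ¬ HasCopy (colorGraph c 3) (SimpleGraph.cycleGraph 4) := by
  exact ⟨color48, no_tri, no_k4, no_c4 2 c4_two, no_c4 3 c4_three⟩
end
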